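/- Let $T_{q_0}$ be an initial invertible transducer with inverse $S_{(\epsilon,q_0)}$. Then $TS \in \mathfrak{P}_n$, the state $(q_0,(\epsilon,q_0))$ of the product transducer $TS$ induces the identity homeomorphism, and $V_n \leq \mathcal{H}(TS)$. -/

import Mathlib

open Classical

noncomputable section

/-- `n`-ary Cantor space: infinite words over the alphabet `Fin n`. -/
abbrev Cantor (n : ℕ) : Type := ℕ → Fin n

/-- The finite word `w` is a prefix of the infinite word `χ`. -/
def PrefixOf {n : ℕ} (w : List (Fin n)) (χ : Cantor n) : Prop :=
  ∀ (i : ℕ) (h : i < w.length), w.get ⟨i, h⟩ = χ i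

/-- Concatenation of a finite word with an infinite word. -/
def appendInf {n : ℕ} (w : List (Fin n)) (χ : Cantor n) : Cantor n :=
  fun i => if h : i < w.length then w.get ⟨i, h⟩ else χ (i - w.length)

/-- The cone (basic clopen set) of infinite words having the finite word `w` as prefix. -/
def cone {n : ℕ} (w : List (Fin n)) : Set (Cantor n) :=
  {χ | PrefixOf w χ}

/-- The length-`k` prefix of an infinite word, as a finite word. -/
def takeW {n : ℕ} (χ : Cantor n) (k : ℕ) : List (Fin n) :=
  List.ofFn (fun i : Fin k => χ i)

/-- A finite family of finite words forming a maximal antichain: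
every infinite word has exactly one member of the family as a prefix. -/
def AntichainFam {n m : ℕ} (α : Fin m → List (Fin n)) : Prop :=
  ∀ χ : Cantor n, ∃! i : Fin m, PrefixOf (α i) χ

/-- The group structure on self-homeomorphisms of a topological space,
with `f * g` acting as `g` followed by `f`. -/
instance homeoGroup {X : Type*} [TopologicalSpace X] : Group (X ≃ₜ X) where
  mul f g := g.trans f
  one := Homeomorph.refl X
  inv := Homeomorph.symm
  mul_assoc a b c := Homeomorph.ext fun _ => rfl
  one_mul a := Homeomorph.ext fun _ => rfl
  mul_one a := Homeomorph.ext fun _ => rfl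
  inv_mul_cancel a := Homeomorph.ext fun x => a.symm_apply_apply x

/-- The Higman–Thompson group `Vₙ`, as the set of self-homeomorphisms of Cantor space
which act by exchanging finite prefixes along a pair of maximal antichains. -/
def Vn (n : ℕ) : Set (Cantor n ≃ₜ Cantor n) :=
  {g | ∃ (m : ℕ) (α β : Fin m → List (Fin n)), AntichainFam α ∧ AntichainFam β ∧
      ∀ (i : Fin m) (χ : Cantor n), g (appendInf (α i) χ) = appendInf (β i) χ}

/-- Conjugation in the paper's right-action convention: `paperConj g v = g⁻¹ v g`,
i.e. the homeomorphism `x ↦ (x) g⁻¹ v g` (first apply `g⁻¹`, then `v`, then `g`). -/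
def paperConj {n : ℕ} (g v : Cantor n ≃ₜ Cantor n) : Cantor n ≃ₜ Cantor n :=
  (g.symm.trans v).trans g

/-- `l` is the longest common prefix of the set `A` of infinite words. -/
def IsLCP {n : ℕ} (A : Set (Cantor n)) (l : List (Fin n)) : Prop :=
  (∀ ρ ∈ A, PrefixOf l ρ) ∧
    ∀ l' : List (Fin n), (∀ ρ ∈ A, PrefixOf l' ρ) → l'.length ≤ l.length

/-- A (not necessarily finite-state) transducer over the alphabet `Fin n`. -/
structure Transducer (n : ℕ) where
  /-- the set of states -/
  Q : Type
  /-- the transition function -/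
  tr : Fin n → Q → Q
  /-- the output (rewrite) function -/
  out : Fin n → Q → List (Fin n)

namespace Transducer

variable {n : ℕ}

/-- The transition function extended to finite words. -/
def transStar (T : Transducer n) : List (Fin n) → T.Q → T.Q
  | [], q => q
  | x :: w, q => T.transStar w (T.tr x q)

/-- The output function extended to finite words. -/
def outStar (T : Transducer n) : List (Fin n) → T.Q → List (Fin n)
  | [], _ => []
  | x :: w, q => T.out x q ++ T.outStar w (T.tr x q)

/-- The initial transducer `T_q` induces the map `f` on Cantor space: the outputs along
ever longer prefixes of `χ` are ever longer prefixes of `f χ`. -/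
def Induces (T : Transducer n) (q : T.Q) (f : Cantor n → Cantor n) : Prop :=
  ∀ (χ : Cantor n) (m : ℕ), ∃ k : ℕ,
    m ≤ (T.outStar (takeW χ k) q).length ∧ PrefixOf (T.outStar (takeW χ k) q) (f χ)

/-- The image of the state `q`: the image of Cantor space under the map induced by `T_q`. -/
def stateImage (T : Transducer n) (q : T.Q) : Set (Cantor n) :=
  {y | ∃ (f : Cantor n → Cantor n) (χ : Cantor n), T.Induces q f ∧ f χ = y}

/-- `T` is synchronizing at level `k`: the state reached after reading any word of
length `k` does not depend on the starting state. -/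
def SyncAtLevel (T : Transducer n) (k : ℕ) : Prop :=
  ∀ w : List (Fin n), w.length = k → ∀ q q' : T.Q, T.transStar w q = T.transStar w q'

/-- `T` is synchronizing if it is synchronizing at some level. -/
def Synchronizing (T : Transducer n) : Prop := ∃ k, T.SyncAtLevel k

/-- `T` (inducing the homeomorphism `h` at `q0`) is one-way synchronizing: `T` is
synchronizing, but the inverse homeomorphism is not induced by any finite
synchronizing transducer (equivalently, the inverse transducer is not synchronizing). -/
def OneWaySync (T : Transducer n) (q0 : T.Q) (h : Cantor n ≃ₜ Cantor n) : Prop :=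
  T.Induces q0 ⇑h ∧ T.Synchronizing ∧
    ¬ ∃ (S : Transducer n) (_ : Finite S.Q) (s0 : S.Q),
        S.Induces s0 ⇑h.symm ∧ S.Synchronizing

/-- `T` is equal to its core : every state is reached by reading a word of length `k`
from some state, for every synchronizing level `k`. -/
def EqualToCore (T : Transducer n) : Prop :=
  ∀ k : ℕ, T.SyncAtLevel k → ∀ q : T.Q, ∃ (w : List (Fin n)) (p : T.Q),
    w.length = k ∧ T.transStar w p = q

/-- Every state of `T` is accessible from `q0`. -/
def Accessible (T : Transducer n) (q0 : T.Q) : Prop :=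
  ∀ q : T.Q, ∃ w : List (Fin n), T.transStar w q0 = q

/-- The product transducer `T S` (first act by `T`, then by `S`). -/
def prod (T S : Transducer n) : Transducer n where
  Q := T.Q × S.Q
  tr := fun x p => (T.tr x p.1, S.transStar (T.out x p.1) p.2)
  out := fun x p => S.outStar (T.out x p.1) p.2

/-- `T` is partially invertible: every state induces an injective map on Cantor space
with clopen image. -/
def PartiallyInvertible (T : Transducer n) : Prop :=
  ∀ q : T.Q, ∃ f : Cantor n → Cantor n,
    T.Induces q f ∧ Function.Injective f ∧ IsClopen (Set.range f)

/-- `T` has no states of incomplete response: for each state `q` and letter `i`, no word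
strictly longer than `λ(i,q)` is a common prefix of the outputs on all of the cone `[i]`. -/
def NoIncompleteResponse (T : Transducer n) : Prop :=
  ∀ (q : T.Q) (i x : Fin n),
    ¬ ∀ χ : Cantor n, ∃ k : ℕ, (T.out i q ++ [x]) <+: T.outStar (i :: takeW χ k) q

/-- States `q` of `T` and `p` of `S` are `ω`-equivalent: they induce one and the same
map on Cantor space. -/
def OmegaEq (T : Transducer n) (q : T.Q) (S : Transducer n) (p : S.Q) : Prop :=
  ∃ f : Cantor n → Cantor n, T.Induces q f ∧ S.Induces p f

/-- `T` is minimal: no states of incomplete response and no pair of distinct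
`ω`-equivalent states. -/
def Minimal (T : Transducer n) : Prop :=
  T.NoIncompleteResponse ∧ ∀ q q' : T.Q, T.OmegaEq q T q' → q = q'

/-- The map on Cantor space induced by the state `q` (junk value if none exists). -/
def inducedMap (T : Transducer n) (q : T.Q) : Cantor n → Cantor n :=
  if h : ∃ f, T.Induces q f then h.choose else id

/-- `𝓛_q(α)`: the longest common prefix of the preimage of the cone `[α]` under `T_q`
(junk value if it does not exist). -/
def lcp (T : Transducer n) (q : T.Q) (α : List (Fin n)) : List (Fin n) :=
  if h : ∃ l, IsLCP {ρ : Cantor n | T.inducedMap q ρ ∈ cone α} l then h.choose else []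

/-- The inverse transducer of `T` given by the inversion algorithm, on the set of all
pairs `(w, q)`: reading `x` from `(w,q)` outputs `𝓛_q(wx)` and moves to
`(wx - λ(𝓛_q(wx), q), π(𝓛_q(wx), q))`. -/
def invT (T : Transducer n) : Transducer n where
  Q := List (Fin n) × T.Q
  tr := fun x p =>
    ((p.1 ++ [x]).drop (T.outStar (T.lcp p.2 (p.1 ++ [x])) p.2).length,
      T.transStar (T.lcp p.2 (p.1 ++ [x])) p.2)
  out := fun x p => T.lcp p.2 (p.1 ++ [x])

/-- Restriction of a transducer to a set of states (transitions leaving the set are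
replaced by junk loops; for transition-closed sets this is the honest restriction). -/
def restrictTo (T : Transducer n) (P : T.Q → Prop) : Transducer n where
  Q := {q : T.Q // P q}
  tr := fun x q => if h : P (T.tr x q.1) then ⟨T.tr x q.1, h⟩ else q
  out := fun x q => T.out x q.1

/-- The set of states reachable from `q0`. -/
def reach (T : Transducer n) (q0 : T.Q) : T.Q → Prop :=
  fun q => ∃ w : List (Fin n), T.transStar w q0 = q

/-- The inverse transducer of the initial transducer `T_{q0}`, with state set the states
accessible from `(ε, q0)`. -/
def invAcc (T : Transducer n) (q0 : T.Q) : Transducer n :=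
  (T.invT).restrictTo ((T.invT).reach ([], q0))

/-- A pair `(w,p)` is good if `[w] ⊆ im(T_p)` and `𝓛_p(w) = ε`. -/
def GoodPair (T : Transducer n) (p : List (Fin n) × T.Q) : Prop :=
  cone p.1 ⊆ T.stateImage p.2 ∧
    IsLCP {ρ : Cantor n | T.inducedMap p.2 ρ ∈ cone p.1} []

/-- The partial inverse `T'` of a partially invertible transducer `T`: the inverse
transducer restricted to the good pairs `(w,p)` with `[w] ⊆ im(T_p)`, `𝓛_p(w) = ε`. -/
def partialInv (T : Transducer n) : Transducer n :=
  (T.invT).restrictTo T.GoodPair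

/-- `h` is a completion of `T`: there are a maximal antichain `η` and an effective viable
combination `(ρ, p)` such that `h` maps `η_i χ` to `ρ_i (χ)T_{p_i}`. -/
def IsCompletion (T : Transducer n) (h : Cantor n ≃ₜ Cantor n) : Prop :=
  ∃ (l : ℕ) (η ρ : Fin l → List (Fin n)) (p : Fin l → T.Q)
      (f : Fin l → (Cantor n → Cantor n)),
    l % (n - 1) = 1 % (n - 1) ∧
    AntichainFam η ∧
    (∀ i, T.Induces (p i) (f i)) ∧
    (⋃ i, appendInf (ρ i) '' Set.range (f i)) = Set.univ ∧
    (∀ i j, i ≠ j →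
      Disjoint (appendInf (ρ i) '' Set.range (f i))
        (appendInf (ρ j) '' Set.range (f j))) ∧
    ∀ (i : Fin l) (χ : Cantor n), h (appendInf (η i) χ) = appendInf (ρ i) (f i χ)

/-- The group `𝓗(T)` generated by all completions of `T`. -/
def HGroup (T : Transducer n) : Subgroup (Cantor n ≃ₜ Cantor n) :=
  Subgroup.closure {h | T.IsCompletion h}

/-- The subgroup-generating equivalence relation induced by the automaton underlying a
transducer `A` with start state `a0` (by Lemma 4.1, two words are related iff the states
they reach are identified by the collapsing procedure, i.e. iff the reached states
transition identically on all sufficiently long words). -/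
def simA (A : Transducer n) (a0 : A.Q) (α β : List (Fin n)) : Prop :=
  ∃ i : ℕ, ∀ w : List (Fin n), w.length = i →
    A.transStar w (A.transStar α a0) = A.transStar w (A.transStar β a0)

/-- `if b then T else T'`. -/
def factor (T : Transducer n) (b : Bool) : Transducer n :=
  if b then T else T.partialInv

/-- The product of a nonempty list of factors, each equal to `T` or its partial
inverse `T'`; these products make up the set `Π(T)`. -/
def prodOf (T : Transducer n) : List Bool → Transducer n
  | [] => T
  | [b] => T.factor b
  | b :: c :: rest => (T.factor b).prod (T.prodOf (c :: rest))

/-- `T` is contracting: every state of every product of copies of `T` and `T'` is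
`ω`-equivalent to an initial transducer which, after reading some fixed length of input,
always acts as a state of `T`. -/
def Contracting (T : Transducer n) : Prop :=
  ∀ L : List Bool, L ≠ [] → ∀ q : (T.prodOf L).Q,
    ∃ (V : Transducer n) (p : V.Q) (f : Cantor n → Cantor n),
      (T.prodOf L).Induces q f ∧ V.Induces p f ∧
      ∃ j : ℕ, ∀ w : List (Fin n), w.length = j →
        ∃ (u : T.Q) (g : Cantor n → Cantor n),
          V.Induces (V.transStar w p) g ∧ T.Induces u g

end Transducer

/-- The element `v` of `Vₙ` preserves the relation `r` on nonempty finite words: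
whenever `v` replaces the prefix `α` by `β`, the words `α` and `β` are related. -/
def PreservesRel {n : ℕ} (r : List (Fin n) → List (Fin n) → Prop)
    (g : Cantor n ≃ₜ Cantor n) : Prop :=
  ∀ (α β : List (Fin n)), α ≠ [] → β ≠ [] →
    (∀ χ : Cantor n, g (appendInf α χ) = appendInf β χ) → r α β

/-- The subgroup `V_∼` of `Vₙ` generated by the prefix-exchange homeomorphisms
preserving the relation `r`. -/
def VSim (n : ℕ) (r : List (Fin n) → List (Fin n) → Prop) :
    Subgroup (Cantor n ≃ₜ Cantor n) :=
  Subgroup.closure {g | g ∈ Vn n ∧ PreservesRel r g}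

/-- `f` coincides with `g` on the cone `[α]` (conjugated into the cone) and is the
identity off the cone: the homeomorphism `[α]_g`. -/
def IsRestrTo {n : ℕ} (α : List (Fin n)) (g f : Cantor n ≃ₜ Cantor n) : Prop :=
  (∀ χ : Cantor n, f (appendInf α χ) = appendInf α (g χ)) ∧
  ∀ χ : Cantor n, ¬ PrefixOf α χ → f χ = χ

/-- The Nekrashevych group `Vₙ(G)`: the group generated by `Vₙ` together with all the
homeomorphisms `[α]_g` for `g ∈ G`. -/
def NekG (n : ℕ) (G : Subgroup (Cantor n ≃ₜ Cantor n)) :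
    Subgroup (Cantor n ≃ₜ Cantor n) :=
  Subgroup.closure (Vn n ∪ {f | ∃ (α : List (Fin n)) (g : Cantor n ≃ₜ Cantor n),
    g ∈ G ∧ IsRestrTo α g f})

/-- The homeomorphism `f` locally agrees with the set `G` of homeomorphisms. -/
def LocallyAgrees {n : ℕ} (G : Set (Cantor n ≃ₜ Cantor n))
    (f : Cantor n ≃ₜ Cantor n) : Prop :=
  ∀ x : Cantor n, ∃ U : Set (Cantor n), IsOpen U ∧ x ∈ U ∧
    ∃ g ∈ G, Set.EqOn ⇑f ⇑g U

/-- A finite synchronous invertible transducer over `Fin n`: each state rewrites single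
letters to single letters bijectively. -/
structure SyncTransducer (n : ℕ) where
  /-- the set of states -/
  Q : Type
  /-- there are finitely many states -/
  fin : Finite Q
  /-- the transition function -/
  tr : Fin n → Q → Q
  /-- the (single-letter) output function -/
  out : Fin n → Q → Fin n
  /-- each state rewrites letters bijectively -/
  bij : ∀ q : Q, Function.Bijective fun x => out x q

namespace SyncTransducer

variable {n : ℕ}

/-- The transition function extended to finite words. -/
def trStar (U : SyncTransducer n) : List (Fin n) → U.Q → U.Q
  | [], q => q
  | x :: w, q => U.trStar w (U.tr x q)

/-- The output function extended to finite words. -/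
def outWord (U : SyncTransducer n) : List (Fin n) → U.Q → List (Fin n)
  | [], _ => []
  | x :: w, q => U.out x q :: U.outWord w (U.tr x q)

/-- The map on Cantor space induced by the initial transducer `U_q`. -/
def applyFun (U : SyncTransducer n) (q : U.Q) (χ : Cantor n) : Cantor n :=
  fun i => U.out (χ i) (U.trStar (takeW χ i) q)

/-- The inverse transducer of a synchronous invertible transducer. -/
def inv (U : SyncTransducer n) : SyncTransducer n where
  Q := U.Q
  fin := U.fin
  tr := fun y q => U.tr ((Equiv.ofBijective _ (U.bij q)).symm y) q
  out := fun y q => (Equiv.ofBijective _ (U.bij q)).symm y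
  bij := fun q => (Equiv.ofBijective _ (U.bij q)).symm.bijective

/-- The product of synchronous transducers (first act by `T`, then by `S`). -/
def sprod (T S : SyncTransducer n) : SyncTransducer n where
  Q := T.Q × S.Q
  fin := by
    haveI := T.fin; haveI := S.fin
    infer_instance
  tr := fun x p => (T.tr x p.1, S.tr (T.out x p.1) p.2)
  out := fun x p => S.out (T.out x p.1) p.2
  bij := fun p => (S.bij p.2).comp (T.bij p.1)

/-- `U` is synchronizing at level `k`. -/
def SyncAtLevel (U : SyncTransducer n) (k : ℕ) : Prop :=
  ∀ w : List (Fin n), w.length = k → ∀ q q' : U.Q, U.trStar w q = U.trStar w q'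

/-- `U` is synchronizing. -/
def Synchronizing (U : SyncTransducer n) : Prop := ∃ k, U.SyncAtLevel k

/-- `U` is minimal (under `ω`-equivalence): distinct states induce distinct maps. -/
def Minimal (U : SyncTransducer n) : Prop :=
  ∀ q q' : U.Q, U.applyFun q = U.applyFun q' → q = q'

/-- One-way synchronizing: `U` is synchronizing but the inverse homeomorphism of
`h = U_{q0}` is not induced by any finite synchronizing transducer. -/
def OneWaySync (U : SyncTransducer n) (h : Cantor n ≃ₜ Cantor n) : Prop :=
  U.Synchronizing ∧
    ¬ ∃ (S : Transducer n) (_ : Finite S.Q) (s0 : S.Q),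
        S.Induces s0 ⇑h.symm ∧ S.Synchronizing

/-- `U` is equal to its core. -/
def EqualToCore (U : SyncTransducer n) : Prop :=
  ∀ k : ℕ, U.SyncAtLevel k → ∀ q : U.Q, ∃ (w : List (Fin n)) (p : U.Q),
    w.length = k ∧ U.trStar w p = q

/-- The underlying (asynchronous-format) transducer of a synchronous transducer. -/
def toT (U : SyncTransducer n) : Transducer n :=
  ⟨U.Q, U.tr, fun x q => [U.out x q]⟩

/-- The automaton group `𝒢(U)` generated by `U`: the subgroup of the homeomorphism
group of Cantor space generated by the homeomorphisms `U_q` for the states `q`. -/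
def autG (U : SyncTransducer n) : Subgroup (Cantor n ≃ₜ Cantor n) :=
  Subgroup.closure {f : Cantor n ≃ₜ Cantor n | ∃ q : U.Q, ⇑f = U.applyFun q}

end SyncTransducer

/-! ### Finite and infinite words -/

section Words

variable {n : ℕ}

theorem takeW_length (χ : Cantor n) (k : ℕ) : (takeW χ k).length = k := by
  simp [takeW]

theorem takeW_eq_takeW_iff (χ ψ : Cantor n) (k : ℕ) :
    takeW χ k = takeW ψ k ↔ ∀ i < k, χ i = ψ i := by
  simp only [takeW, List.ofFn_inj, funext_iff]
  exact ⟨fun h i hi => h ⟨i, hi⟩, fun h i => h i i.2⟩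

theorem prefixOf_iff_takeW (w : List (Fin n)) (χ : Cantor n) :
    PrefixOf w χ ↔ takeW χ w.length = w := by
  constructor
  · intro h
    apply List.ext_getElem
    · simp [takeW]
    · intro i h1 h2
      have := h i h2
      simp [takeW] at this ⊢
      exact this.symm
  · intro h i hi
    have h2 : (takeW χ w.length)[i]'(by rw [takeW_length]; exact hi) = w[i] := by
      simp only [h]
    rw [List.get_eq_getElem, ← h2]
    simp [takeW]

theorem prefixOf_takeW (χ : Cantor n) (k : ℕ) : PrefixOf (takeW χ k) χ := by
  rw [prefixOf_iff_takeW, takeW_length]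

theorem appendInf_of_lt (w : List (Fin n)) (χ : Cantor n) {i : ℕ} (h : i < w.length) :
    appendInf w χ i = w[i] := by
  simp [appendInf, h]

theorem appendInf_add (w : List (Fin n)) (χ : Cantor n) (i : ℕ) :
    appendInf w χ (i + w.length) = χ i := by
  simp [appendInf]

theorem prefixOf_appendInf (w : List (Fin n)) (χ : Cantor n) : PrefixOf w (appendInf w χ) := by
  intro i h
  rw [appendInf_of_lt w χ h]
  rfl

theorem appendInf_shift {w : List (Fin n)} {χ : Cantor n} (h : PrefixOf w χ) :
    appendInf w (fun i => χ (i + w.length)) = χ := by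
  funext i
  by_cases hi : i < w.length
  · rw [appendInf_of_lt _ _ hi]
    exact h i hi
  · simp only [appendInf, hi, dite_false]
    congr 1
    omega

theorem prefixOf_iff_exists {w : List (Fin n)} {χ : Cantor n} :
    PrefixOf w χ ↔ ∃ ψ, appendInf w ψ = χ :=
  ⟨fun h => ⟨_, appendInf_shift h⟩, by rintro ⟨ψ, rfl⟩; exact prefixOf_appendInf _ _⟩

theorem appendInf_injective (w : List (Fin n)) : Function.Injective (appendInf w) := by
  intro χ ψ h
  funext i
  rw [← appendInf_add w χ i, h, appendInf_add]

theorem appendInf_append (u v : List (Fin n)) (χ : Cantor n) :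
    appendInf (u ++ v) χ = appendInf u (appendInf v χ) := by
  funext i
  by_cases h1 : i < u.length
  · rw [appendInf_of_lt _ _ h1, appendInf_of_lt _ _ (by simp; omega)]
    simp [h1]
  · obtain ⟨j, rfl⟩ : ∃ j, i = j + u.length := ⟨i - u.length, by omega⟩
    rw [appendInf_add]
    by_cases h2 : j < v.length
    · rw [appendInf_of_lt _ _ h2, appendInf_of_lt _ _ (by simp; omega)]
      simp
    · obtain ⟨k, rfl⟩ : ∃ k, j = k + v.length := ⟨j - v.length, by omega⟩
      rw [appendInf_add]
      have : k + v.length + u.length = k + (u ++ v).length := by simp; omega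
      rw [this, appendInf_add]

theorem appendInf_nil (χ : Cantor n) : appendInf [] χ = χ := by
  funext i
  simp [appendInf]

theorem PrefixOf.isPrefix {u v : List (Fin n)} {χ : Cantor n} (hu : PrefixOf u χ)
    (hv : PrefixOf v χ) (h : u.length ≤ v.length) : u <+: v := by
  rw [List.prefix_iff_eq_take]
  apply List.ext_getElem
  · simpa using h
  · intro i h1 h2
    have a := hu i h1
    have b := hv i (by omega)
    simp at a b ⊢
    rw [a, b]

theorem PrefixOf.of_isPrefix {u v : List (Fin n)} {χ : Cantor n} (hv : PrefixOf v χ)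
    (h : u <+: v) : PrefixOf u χ := by
  obtain ⟨t, rfl⟩ := h
  obtain ⟨ψ, rfl⟩ := prefixOf_iff_exists.1 hv
  rw [appendInf_append]
  exact prefixOf_appendInf _ _

theorem prefixOf_append_appendInf {u v : List (Fin n)} {χ : Cantor n} :
    PrefixOf (u ++ v) (appendInf u χ) ↔ PrefixOf v χ := by
  simp only [prefixOf_iff_exists, appendInf_append]
  constructor
  · rintro ⟨ψ, h⟩
    exact ⟨ψ, appendInf_injective u h⟩
  · rintro ⟨ψ, rfl⟩
    exact ⟨ψ, rfl⟩

theorem takeW_appendInf_add (w : List (Fin n)) (χ : Cantor n) (k : ℕ) :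
    takeW (appendInf w χ) (w.length + k) = w ++ takeW χ k := by
  have h : PrefixOf (w ++ takeW χ k) (appendInf w χ) :=
    prefixOf_append_appendInf.2 (prefixOf_takeW χ k)
  rw [prefixOf_iff_takeW] at h
  simpa [takeW_length] using h

theorem takeW_isPrefix (χ : Cantor n) {k l : ℕ} (h : k ≤ l) : takeW χ k <+: takeW χ l :=
  (prefixOf_takeW χ k).isPrefix (prefixOf_takeW χ l) (by simpa [takeW_length] using h)

theorem prefixOf_nil (χ : Cantor n) : PrefixOf [] χ := fun _ h => absurd h (by simp)

theorem isPrefix_of_forall_cone (hn : 2 ≤ n) {u v : List (Fin n)}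
    (h : ∀ y ∈ cone v, PrefixOf u y) : u <+: v := by
  have key : ∀ a : Fin n, PrefixOf u (appendInf v fun _ => a) := fun a =>
    h _ (prefixOf_appendInf _ _)
  have hl : u.length ≤ v.length := by
    by_contra! hlt
    have h0 := key ⟨0, by omega⟩ v.length hlt
    have h1 := key ⟨1, by omega⟩ v.length hlt
    have h2 := appendInf_add v (fun _ => (⟨0, by omega⟩ : Fin n)) 0
    have h3 := appendInf_add v (fun _ => (⟨1, by omega⟩ : Fin n)) 0
    rw [zero_add] at h2 h3
    rw [h0, h2, h3] at h1
    simp at h1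
  exact (key ⟨0, by omega⟩).isPrefix (prefixOf_appendInf _ _) hl

theorem exists_isLCP {A : Set (Cantor n)} {ρ σ : Cantor n} (hρ : ρ ∈ A) (hσ : σ ∈ A)
    (hne : ρ ≠ σ) : ∃ l, IsLCP A l := by
  obtain ⟨i, hi⟩ := Function.ne_iff.1 hne
  let s : Set ℕ := {k | ∃ l : List (Fin n), (∀ ρ ∈ A, PrefixOf l ρ) ∧ l.length = k}
  have hs : BddAbove s := by
    refine ⟨i, ?_⟩
    rintro k ⟨l, hl, rfl⟩
    by_contra! hlt
    exact hi ((hl ρ hρ i hlt).symm.trans (hl σ hσ i hlt))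
  obtain ⟨l, hl, hk⟩ := Nat.sSup_mem (s := s) ⟨0, [], fun _ _ => prefixOf_nil _, rfl⟩ hs
  refine ⟨l, hl, fun l' hl' => ?_⟩
  rw [hk]
  exact le_csSup hs ⟨l', hl', rfl⟩

theorem IsLCP.append_image {A : Set (Cantor n)} {l : List (Fin n)} (hA : A.Nonempty)
    (h : IsLCP A l) (L : List (Fin n)) : IsLCP (appendInf L '' A) (L ++ l) := by
  refine ⟨?_, fun l' hl' => ?_⟩
  · rintro _ ⟨ρ, hρ, rfl⟩
    exact prefixOf_append_appendInf.2 (h.1 ρ hρ)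
  · by_cases hlen : l'.length ≤ L.length
    · simp; omega
    · obtain ⟨ρ, hρ⟩ := hA
      obtain ⟨t, rfl⟩ := (prefixOf_appendInf L ρ).isPrefix (hl' _ ⟨ρ, hρ, rfl⟩)
        (by omega : L.length ≤ l'.length)
      have := h.2 t fun σ hσ => prefixOf_append_appendInf.1 (hl' _ ⟨σ, hσ, rfl⟩)
      simpa using this

theorem continuous_appendInf (w : List (Fin n)) : Continuous (appendInf w) := by
  refine continuous_pi fun i => ?_
  by_cases h : i < w.length
  · simp only [appendInf, h, dite_true]
    exact continuous_const
  · simp only [appendInf, h, dite_false]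
    exact continuous_apply _

theorem continuous_shift (k : ℕ) : Continuous fun (χ : Cantor n) i => χ (i + k) :=
  continuous_pi fun _ => continuous_apply _

theorem isClopen_cone (w : List (Fin n)) : IsClopen (cone w) := by
  have : cone w = ⋂ i : Fin w.length, (fun χ : Cantor n => χ i) ⁻¹' {w.get i} := by
    ext χ
    simp only [cone, PrefixOf, Set.mem_ofPred_eq, Set.mem_iInter, Set.mem_preimage,
      Set.mem_singleton_iff]
    exact ⟨fun h i => (h i i.2).symm, fun h i hi => (h ⟨i, hi⟩).symm⟩
  rw [this]
  exact isClopen_iInter_of_finite fun i =>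
    (isClopen_discrete {w.get i}).preimage (continuous_apply _)

theorem isClopen_appendInf_image (w : List (Fin n)) {C : Set (Cantor n)} (hC : IsClopen C) :
    IsClopen (appendInf w '' C) := by
  have : appendInf w '' C = cone w ∩ (fun (χ : Cantor n) i => χ (i + w.length)) ⁻¹' C := by
    ext χ
    constructor
    · rintro ⟨ψ, hψ, rfl⟩
      refine ⟨prefixOf_appendInf _ _, ?_⟩
      simpa [appendInf_add] using hψ
    · rintro ⟨h1, h2⟩
      exact ⟨_, h2, appendInf_shift h1⟩
  rw [this]
  exact (isClopen_cone w).inter (hC.preimage (continuous_shift _))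

theorem exists_modulus {g : Cantor n → Cantor n} (hg : Continuous g) (m : ℕ) :
    ∃ N, ∀ x y : Cantor n, (∀ i < N, x i = y i) → ∀ i < m, g x i = g y i := by
  have loc : ∀ x : Cantor n, ∃ N, ∀ y : Cantor n, (∀ i < N, y i = x i) →
      ∀ i < m, g y i = g x i := by
    intro x
    have hopen : IsOpen (g ⁻¹' cone (takeW (g x) m)) :=
      (isClopen_cone _).isOpen.preimage hg
    obtain ⟨v, ⟨z, N, rfl⟩, hxv, hv⟩ :=
      (PiNat.isTopologicalBasis_cylinders fun _ => Fin n).exists_subset_of_mem_open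
        (prefixOf_takeW (g x) m : x ∈ g ⁻¹' cone (takeW (g x) m)) hopen
    refine ⟨N, fun y hy => ?_⟩
    have hyv : PrefixOf (takeW (g x) m) (g y) :=
      hv (fun i hi => (hy i hi).trans (hxv i hi) : y ∈ PiNat.cylinder z N)
    rw [prefixOf_iff_takeW, takeW_length, takeW_eq_takeW_iff] at hyv
    exact hyv
  choose N hN using loc
  obtain ⟨t, ht⟩ := (isCompact_univ (X := Cantor n)).elim_nhds_subcover
    (fun x => cone (takeW x (N x)))
    fun x _ => (isClopen_cone _).isOpen.mem_nhds (prefixOf_takeW _ _)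
  refine ⟨t.sup N, fun x y hxy i hi => ?_⟩
  obtain ⟨z, hz, hxz⟩ := Set.mem_iUnion₂.1 (ht.2 (Set.mem_univ x))
  have hxz' : ∀ i < N z, x i = z i := by
    have : PrefixOf (takeW z (N z)) x := hxz
    rwa [prefixOf_iff_takeW, takeW_length, takeW_eq_takeW_iff] at this
  rw [hN z x hxz' i hi, hN z y (fun j hj => ?_) i hi]
  rw [← hxy j (hj.trans_le (Finset.le_sup hz)), hxz' j hj]

theorem AntichainFam.card_mod (hn : 2 ≤ n) {m : ℕ} {α : Fin m → List (Fin n)}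
    (hα : AntichainFam α) : m % (n - 1) = 1 % (n - 1) := by
  let N := Finset.univ.sup fun i => (α i).length
  have hN : ∀ i, (α i).length ≤ N := fun i =>
    Finset.le_sup (f := fun i => (α i).length) (Finset.mem_univ i)
  let z : Cantor n := fun _ => ⟨0, by omega⟩
  let φ : (Σ i, (Fin (N - (α i).length) → Fin n)) → (Fin N → Fin n) := fun p j =>
    appendInf (α p.1) (appendInf (List.ofFn p.2) z) j
  have hφ : Function.Bijective φ := by
    constructor
    · rintro ⟨i, v⟩ ⟨j, w⟩ h
      have hval : ∀ k < N, appendInf (α i) (appendInf (List.ofFn v) z) k =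
          appendInf (α j) (appendInf (List.ofFn w) z) k := fun k hk => congrFun h ⟨k, hk⟩
      obtain rfl : i = j := by
        refine (hα (appendInf (α i) (appendInf (List.ofFn v) z))).unique
          (prefixOf_appendInf _ _) fun k hk => ?_
        rw [hval k (hk.trans_le (hN j))]
        exact prefixOf_appendInf _ _ k hk
      congr 1
      funext k
      have := hval (k + (α i).length) (by omega)
      rw [appendInf_add, appendInf_add, appendInf_of_lt _ _ (by simp),
        appendInf_of_lt _ _ (by simp)] at this
      simpa using this
    · intro w
      obtain ⟨i, hi, -⟩ := hα (appendInf (List.ofFn w) z)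
      refine ⟨⟨i, fun j => w ⟨j + (α i).length, by omega⟩⟩, ?_⟩
      funext k
      have hw : appendInf (List.ofFn w) z k = w k := by
        rw [appendInf_of_lt _ _ (by simp)]
        simp
      by_cases hk : (k : ℕ) < (α i).length
      · have := hi k hk
        simp only [φ]
        rw [appendInf_of_lt _ _ hk, ← hw, ← this]
        rfl
      · obtain ⟨j, hj⟩ : ∃ j, (k : ℕ) = j + (α i).length := ⟨k - (α i).length, by omega⟩
        simp only [φ]
        rw [hj, appendInf_add, appendInf_of_lt _ _ (by simp; omega)]
        simp only [List.getElem_ofFn]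
        congr 1
        exact Fin.ext hj.symm
  have hcard := Fintype.card_of_bijective hφ
  simp only [Fintype.card_sigma, Fintype.card_fun, Fintype.card_fin] at hcard
  have hone : ∀ k, n ^ k ≡ 1 [MOD n - 1] := fun k => by
    have : n ≡ 1 [MOD n - 1] := ((Nat.modEq_iff_dvd' (by omega)).2 dvd_rfl).symm
    simpa using this.pow k
  have hsum : ∑ i : Fin m, n ^ (N - (α i).length) ≡ ∑ _i : Fin m, 1 [MOD n - 1] := by
    have := fun i : Fin m => (ZMod.natCast_eq_natCast_iff _ _ _).2 (hone (N - (α i).length))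
    rw [← ZMod.natCast_eq_natCast_iff]
    push_cast at this ⊢
    exact Finset.sum_congr rfl fun i _ => this i
  rw [hcard] at hsum
  simpa [Nat.ModEq] using hsum.symm.trans (hone N)

end Words

namespace Transducer

variable {n : ℕ}

/-! ### Induced maps -/

theorem transStar_append (T : Transducer n) (u v : List (Fin n)) (q : T.Q) :
    T.transStar (u ++ v) q = T.transStar v (T.transStar u q) := by
  induction u generalizing q with
  | nil => rfl
  | cons x u ih => exact ih _

theorem outStar_append (T : Transducer n) (u v : List (Fin n)) (q : T.Q) :
    T.outStar (u ++ v) q = T.outStar u q ++ T.outStar v (T.transStar u q) := by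
  induction u generalizing q with
  | nil => rfl
  | cons x u ih => simp [outStar, transStar, ih]

theorem outStar_isPrefix (T : Transducer n) {u v : List (Fin n)} (h : u <+: v) (q : T.Q) :
    T.outStar u q <+: T.outStar v q := by
  obtain ⟨t, rfl⟩ := h
  rw [outStar_append]
  exact List.prefix_append _ _

theorem Induces.exists_ge {T : Transducer n} {q : T.Q} {f : Cantor n → Cantor n}
    (hf : T.Induces q f) (χ : Cantor n) (m l : ℕ) :
    ∃ k, l ≤ k ∧ m ≤ (T.outStar (takeW χ k) q).length ∧
      PrefixOf (T.outStar (takeW χ k) q) (f χ) := by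
  obtain ⟨k, hk, hp⟩ := hf χ (m + (T.outStar (takeW χ l) q).length + 1)
  refine ⟨k, ?_, by omega, hp⟩
  by_contra! hlt
  have := (T.outStar_isPrefix (takeW_isPrefix χ hlt.le) q).length_le
  omega

theorem Induces.prefixOf {T : Transducer n} {q : T.Q} {f : Cantor n → Cantor n}
    (hf : T.Induces q f) (χ : Cantor n) (l : ℕ) : PrefixOf (T.outStar (takeW χ l) q) (f χ) := by
  obtain ⟨k, hk, -, hp⟩ := hf.exists_ge χ 0 l
  exact hp.of_isPrefix (T.outStar_isPrefix (takeW_isPrefix χ hk) q)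

theorem Induces.prefixOf_appendInf {T : Transducer n} {q : T.Q} {f : Cantor n → Cantor n}
    (hf : T.Induces q f) (w : List (Fin n)) (χ : Cantor n) :
    PrefixOf (T.outStar w q) (f (appendInf w χ)) := by
  have := hf.prefixOf (appendInf w χ) w.length
  rwa [(prefixOf_iff_takeW _ _).1 (_root_.prefixOf_appendInf w χ)] at this

theorem Induces.unique {T : Transducer n} {q : T.Q} {f g : Cantor n → Cantor n}
    (hf : T.Induces q f) (hg : T.Induces q g) : f = g := by
  funext χ i
  obtain ⟨k, hk, hp⟩ := hf χ (i + 1)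
  rw [← hp i (by omega), hg.prefixOf χ k i (by omega)]

theorem Induces.inducedMap_eq {T : Transducer n} {q : T.Q} {f : Cantor n → Cantor n}
    (hf : T.Induces q f) : T.inducedMap q = f := by
  have h : ∃ f, T.Induces q f := ⟨f, hf⟩
  rw [inducedMap, dif_pos h]
  exact h.choose_spec.unique hf

theorem Induces.exists_transStar {T : Transducer n} {q : T.Q} {f : Cantor n → Cantor n}
    (hf : T.Induces q f) (w : List (Fin n)) :
    ∃ g, T.Induces (T.transStar w q) g ∧
      ∀ χ, f (appendInf w χ) = appendInf (T.outStar w q) (g χ) := by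
  have heq : ∀ χ, f (appendInf w χ) = appendInf (T.outStar w q)
      (fun i => f (appendInf w χ) (i + (T.outStar w q).length)) := fun χ =>
    (appendInf_shift (hf.prefixOf_appendInf w χ)).symm
  refine ⟨fun χ i => f (appendInf w χ) (i + (T.outStar w q).length), fun χ m => ?_, heq⟩
  obtain ⟨k, hk, hm, hp⟩ := hf.exists_ge (appendInf w χ) (m + (T.outStar w q).length) w.length
  obtain ⟨j, rfl⟩ := Nat.exists_eq_add_of_le hk
  rw [takeW_appendInf_add, outStar_append] at hm hp
  refine ⟨j, by simp at hm; omega, ?_⟩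
  rw [heq χ, prefixOf_append_appendInf] at hp
  exact hp

theorem prod_outStar (T S : Transducer n) (w : List (Fin n)) (t : T.Q) (s : S.Q) :
    (T.prod S).outStar w (t, s) = S.outStar (T.outStar w t) s := by
  induction w generalizing t s with
  | nil => rfl
  | cons x w ih =>
    have hcons : T.outStar (x :: w) t = T.out x t ++ T.outStar w (T.tr x t) := rfl
    rw [hcons, outStar_append]
    exact congrArg _ (ih _ _)

theorem Induces.prod {T S : Transducer n} {t : T.Q} {s : S.Q} {f g : Cantor n → Cantor n}
    (hf : T.Induces t f) (hg : S.Induces s g) : (T.prod S).Induces (t, s) (g ∘ f) := by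
  intro χ m
  obtain ⟨k', hk', -⟩ := hg (f χ) m
  obtain ⟨k, hk, hp⟩ := hf χ k'
  have heq := (prefixOf_iff_takeW _ _).1 hp
  refine ⟨k, ?_, ?_⟩ <;> rw [prod_outStar, ← heq]
  · exact hk'.trans (S.outStar_isPrefix (takeW_isPrefix _ hk) s).length_le
  · exact hg.prefixOf _ _

/-- Every state of `T` induces a map that is a homeomorphism onto a clopen image, with a uniform
modulus of continuity for the inverse. -/
structure LocalHomeo (T : Transducer n) (q : T.Q) : Prop where
  induces : T.Induces q (T.inducedMap q)
  injective : Function.Injective (T.inducedMap q)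
  continuous : Continuous (T.inducedMap q)
  isClopen_range : IsClopen (Set.range (T.inducedMap q))
  modulus : ∀ m, ∃ N, ∀ ρ σ : Cantor n,
    (∀ i < N, T.inducedMap q ρ i = T.inducedMap q σ i) → ∀ i < m, ρ i = σ i

theorem localHomeo_of_accessible {T : Transducer n} {q0 : T.Q} {h : Cantor n ≃ₜ Cantor n}
    (hInd : T.Induces q0 ⇑h) (hAcc : T.Accessible q0) (q : T.Q) : T.LocalHomeo q := by
  obtain ⟨w, rfl⟩ := hAcc q
  obtain ⟨g, hg, heq⟩ := hInd.exists_transStar w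
  have hinj : Function.Injective g := fun ρ σ hρσ =>
    appendInf_injective w (h.injective (by rw [heq, heq, hρσ]))
  obtain rfl := hg.inducedMap_eq
  set F := T.inducedMap (T.transStar w q0) with hF
  have hcomp : F = fun χ i => h (appendInf w χ) (i + (T.outStar w q0).length) := by
    funext χ i
    rw [heq, appendInf_add]
  have hrange : Set.range F = appendInf (T.outStar w q0) ⁻¹' (h '' cone w) := by
    ext y
    constructor
    · rintro ⟨χ, rfl⟩
      exact ⟨appendInf w χ, prefixOf_appendInf _ _, heq χ⟩
    · rintro ⟨χ, hχ, hy⟩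
      obtain ⟨ψ, rfl⟩ := prefixOf_iff_exists.1 hχ
      exact ⟨ψ, appendInf_injective _ ((heq ψ).symm.trans hy)⟩
  refine ⟨hg, hinj, ?_, ?_, fun m => ?_⟩
  · rw [← hF, hcomp]
    exact (continuous_shift _).comp (h.continuous.comp (continuous_appendInf w))
  · rw [← hF, hrange]
    refine IsClopen.preimage ?_ (continuous_appendInf _)
    exact ⟨h.isClosedMap _ (isClopen_cone w).1, h.isOpenMap _ (isClopen_cone w).2⟩
  · obtain ⟨N, hN⟩ := exists_modulus h.symm.continuous (m + w.length)
    refine ⟨N, fun ρ σ hρσ i hi => ?_⟩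
    have := hN (h (appendInf w ρ)) (h (appendInf w σ)) (fun j hj => ?_) (i + w.length) (by omega)
    · simpa [appendInf_add] using this
    · rw [heq, heq]
      by_cases hj' : j < (T.outStar w q0).length
      · rw [appendInf_of_lt _ _ hj', appendInf_of_lt _ _ hj']
      · obtain ⟨k, rfl⟩ : ∃ k, j = k + (T.outStar w q0).length :=
          ⟨j - (T.outStar w q0).length, by omega⟩
        rw [appendInf_add, appendInf_add]
        exact hρσ k (by omega)

/-! ### The inverse transducer -/

/-- The pair `(w, q)` satisfies `[w] ⊆ im(T_q)` and the preimage of `[w]` under `T_q` has empty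
longest common prefix. -/
def InverseState (T : Transducer n) (p : List (Fin n) × T.Q) : Prop :=
  cone p.1 ⊆ Set.range (T.inducedMap p.2) ∧
    IsLCP {ρ : Cantor n | T.inducedMap p.2 ρ ∈ cone p.1} []

theorem nonempty_preimage_cone (hn : 2 ≤ n) {T : Transducer n} {q : T.Q} {v : List (Fin n)}
    (hv : cone v ⊆ Set.range (T.inducedMap q)) :
    {ρ : Cantor n | T.inducedMap q ρ ∈ cone v}.Nonempty := by
  obtain ⟨ρ, hρ⟩ := hv (prefixOf_appendInf v fun _ => (⟨0, by omega⟩ : Fin n))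
  exact ⟨ρ, by rw [Set.mem_ofPred_eq, hρ]; exact prefixOf_appendInf _ _⟩

theorem isLCP_lcp (hn : 2 ≤ n) {T : Transducer n} {q : T.Q} {v : List (Fin n)}
    (hv : cone v ⊆ Set.range (T.inducedMap q)) :
    IsLCP {ρ : Cantor n | T.inducedMap q ρ ∈ cone v} (T.lcp q v) := by
  have hex : ∃ l, IsLCP {ρ : Cantor n | T.inducedMap q ρ ∈ cone v} l := by
    have key : ∀ a : Fin n, ∃ ρ, T.inducedMap q ρ = appendInf v fun _ => a := fun a =>
      hv (prefixOf_appendInf v fun _ => a)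
    choose ρ hρ using key
    have hmem : ∀ a, ρ a ∈ {ρ : Cantor n | T.inducedMap q ρ ∈ cone v} := fun a => by
      rw [Set.mem_ofPred_eq, hρ]
      exact prefixOf_appendInf _ _
    refine exists_isLCP (hmem ⟨0, by omega⟩) (hmem ⟨1, by omega⟩) fun he => ?_
    have h1 := congrArg (T.inducedMap q) he
    rw [hρ, hρ] at h1
    have h2 := congrFun (appendInf_injective v h1) 0
    simp at h2
  rw [lcp, dif_pos hex]
  exact hex.choose_spec

theorem inducedMap_appendInf {T : Transducer n} {q : T.Q}
    (hq : T.Induces q (T.inducedMap q)) (w : List (Fin n)) (χ : Cantor n) :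
    T.inducedMap q (appendInf w χ) =
      appendInf (T.outStar w q) (T.inducedMap (T.transStar w q) χ) := by
  obtain ⟨g, hg, heq⟩ := hq.exists_transStar w
  rw [heq, hg.inducedMap_eq]

/-- If `L = 𝓛_q(v)` then `λ(L, q)` is a prefix of `v`. -/
theorem outStar_lcp_isPrefix (hn : 2 ≤ n) {T : Transducer n} {q : T.Q}
    (hq : T.Induces q (T.inducedMap q)) {v : List (Fin n)}
    (hv : cone v ⊆ Set.range (T.inducedMap q)) : T.outStar (T.lcp q v) q <+: v := by
  refine isPrefix_of_forall_cone hn fun y hy => ?_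
  obtain ⟨ρ, rfl⟩ := hv hy
  obtain ⟨σ, rfl⟩ := prefixOf_iff_exists.1 ((isLCP_lcp hn hv).1 ρ hy)
  exact hq.prefixOf_appendInf _ _

theorem preimage_cone_append (hn : 2 ≤ n) {T : Transducer n} {q : T.Q}
    (hq : T.Induces q (T.inducedMap q)) {v v' : List (Fin n)}
    (hv : cone v ⊆ Set.range (T.inducedMap q)) (hv' : v = T.outStar (T.lcp q v) q ++ v')
    (u : List (Fin n)) :
    {ρ : Cantor n | T.inducedMap q ρ ∈ cone (v ++ u)} = appendInf (T.lcp q v) ''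
      {ρ | T.inducedMap (T.transStar (T.lcp q v) q) ρ ∈ cone (v' ++ u)} := by
  have key : ∀ ρ, T.inducedMap q (appendInf (T.lcp q v) ρ) ∈ cone (v ++ u) ↔
      T.inducedMap (T.transStar (T.lcp q v) q) ρ ∈ cone (v' ++ u) := fun ρ => by
    have : v ++ u = T.outStar (T.lcp q v) q ++ (v' ++ u) := by
      rw [← List.append_assoc, ← hv']
    rw [inducedMap_appendInf hq, this]
    exact prefixOf_append_appendInf
  ext ρ
  constructor
  · intro hρ
    have hρv : T.inducedMap q ρ ∈ cone v := PrefixOf.of_isPrefix hρ (List.prefix_append _ _)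
    obtain ⟨σ, rfl⟩ := prefixOf_iff_exists.1 ((isLCP_lcp hn hv).1 ρ hρv)
    exact ⟨σ, (key σ).1 hρ, rfl⟩
  · rintro ⟨σ, hσ, rfl⟩
    exact (key σ).2 hσ

theorem InverseState.cone_append_subset {T : Transducer n} {p : List (Fin n) × T.Q}
    (hp : T.InverseState p) (u : List (Fin n)) :
    cone (p.1 ++ u) ⊆ Set.range (T.inducedMap p.2) := fun _ hy =>
  hp.1 (PrefixOf.of_isPrefix hy (List.prefix_append _ _))

theorem InverseState.tr (hn : 2 ≤ n) {T : Transducer n} (hT : ∀ q, T.LocalHomeo q)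
    {p : List (Fin n) × T.Q} (hp : T.InverseState p) (x : Fin n) :
    T.InverseState (T.invT.tr x p) := by
  obtain ⟨w, q⟩ := p
  have hv : cone (w ++ [x]) ⊆ Set.range (T.inducedMap q) := hp.cone_append_subset [x]
  have hpre := outStar_lcp_isPrefix hn (hT q).induces hv
  have hv' := (List.prefix_iff_eq_append.1 hpre).symm
  have himg := preimage_cone_append hn (hT q).induces hv hv' []
  rw [List.append_nil, List.append_nil] at himg
  have hlcp := isLCP_lcp hn hv
  constructor
  · intro y hy
    have hy' : appendInf (T.outStar (T.lcp q (w ++ [x])) q) y ∈ cone (w ++ [x]) := by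
      have := prefixOf_append_appendInf (u := T.outStar (T.lcp q (w ++ [x])) q).2 hy
      change PrefixOf (_ ++ List.drop _ (w ++ [x])) _ at this
      rwa [← hv'] at this
    obtain ⟨ρ, hρ⟩ := hv hy'
    obtain ⟨σ, rfl⟩ := prefixOf_iff_exists.1 (hlcp.1 ρ (by rw [Set.mem_ofPred_eq, hρ]; exact hy'))
    rw [inducedMap_appendInf (hT q).induces] at hρ
    exact ⟨σ, appendInf_injective _ hρ⟩
  · refine ⟨fun _ _ => prefixOf_nil _, fun l' hl' => ?_⟩
    have := hlcp.2 (T.lcp q (w ++ [x]) ++ l') fun ρ hρ => by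
      rw [himg] at hρ
      obtain ⟨σ, hσ, rfl⟩ := hρ
      exact prefixOf_append_appendInf.2 (hl' σ hσ)
    simpa using this

theorem InverseState.transStar (hn : 2 ≤ n) {T : Transducer n} (hT : ∀ q, T.LocalHomeo q)
    {p : List (Fin n) × T.Q} (hp : T.InverseState p) (u : List (Fin n)) :
    T.InverseState (T.invT.transStar u p) := by
  induction u generalizing p with
  | nil => exact hp
  | cons x u ih => exact ih (hp.tr hn hT x)

/-- The output of the inverse transducer on `u` from the state `(w, q)` is `𝓛_q(wu)`. -/
theorem InverseState.isLCP_outStar (hn : 2 ≤ n) {T : Transducer n} (hT : ∀ q, T.LocalHomeo q)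
    {p : List (Fin n) × T.Q} (hp : T.InverseState p) (u : List (Fin n)) :
    IsLCP {ρ : Cantor n | T.inducedMap p.2 ρ ∈ cone (p.1 ++ u)} (T.invT.outStar u p) := by
  induction u generalizing p with
  | nil =>
    rw [List.append_nil]
    exact hp.2
  | cons x u ih =>
    obtain ⟨w, q⟩ := p
    have hv : cone (w ++ [x]) ⊆ Set.range (T.inducedMap q) := hp.cone_append_subset [x]
    have hpre := outStar_lcp_isPrefix hn (hT q).induces hv
    have hv' := (List.prefix_iff_eq_append.1 hpre).symm
    have himg := preimage_cone_append hn (hT q).induces hv hv' u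
    have hp' := hp.tr hn hT x
    have := (ih hp').append_image (nonempty_preimage_cone hn (hp'.cone_append_subset u))
      (T.lcp q (w ++ [x]))
    rw [List.append_cons, himg]
    exact this

theorem inverseState_initial (hn : 2 ≤ n) {T : Transducer n} {q0 : T.Q}
    {h : Cantor n ≃ₜ Cantor n} (hInd : T.Induces q0 ⇑h) : T.InverseState ([], q0) := by
  refine ⟨fun y _ => ?_, fun _ _ => prefixOf_nil _, fun l' hl' => ?_⟩
  · rw [hInd.inducedMap_eq]
    exact h.surjective y
  · refine (isPrefix_of_forall_cone (v := []) hn fun y _ => hl' y ?_).length_le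
    exact prefixOf_nil _

/-- The partial inverse of the state `q`, preceded by attaching the prefix `w`. -/
def inverseMap (T : Transducer n) (p : List (Fin n) × T.Q) (hp : T.InverseState p)
    (y : Cantor n) : Cantor n :=
  (hp.1 (prefixOf_appendInf p.1 y)).choose

theorem inducedMap_inverseMap (T : Transducer n) (p : List (Fin n) × T.Q)
    (hp : T.InverseState p) (y : Cantor n) :
    T.inducedMap p.2 (T.inverseMap p hp y) = appendInf p.1 y :=
  (hp.1 (prefixOf_appendInf p.1 y)).choose_spec

theorem induces_inverseMap (hn : 2 ≤ n) {T : Transducer n} (hT : ∀ q, T.LocalHomeo q)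
    {p : List (Fin n) × T.Q} (hp : T.InverseState p) :
    T.invT.Induces p (T.inverseMap p hp) := by
  intro y m
  obtain ⟨N, hN⟩ := (hT p.2).modulus m
  have hmem : T.inverseMap p hp y ∈
      {ρ : Cantor n | T.inducedMap p.2 ρ ∈ cone (p.1 ++ takeW y N)} := by
    rw [Set.mem_ofPred_eq, inducedMap_inverseMap]
    exact prefixOf_append_appendInf.2 (prefixOf_takeW _ _)
  have hlcp := hp.isLCP_outStar hn hT (takeW y N)
  refine ⟨N, ?_, hlcp.1 _ hmem⟩
  rw [← takeW_length (T.inverseMap p hp y) m]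
  refine hlcp.2 _ fun ρ hρ => ?_
  rw [prefixOf_iff_takeW, takeW_length, takeW_eq_takeW_iff]
  refine hN _ _ fun i hi => ?_
  have hi' : i < (p.1 ++ takeW y N).length := by simp [takeW_length]; omega
  exact (hρ i hi').symm.trans (hmem i hi')

theorem outStar_restrictTo (T : Transducer n) (P : T.Q → Prop)
    (hP : ∀ x q, P q → P (T.tr x q)) (u : List (Fin n)) (q : {q : T.Q // P q}) :
    (T.restrictTo P).outStar u q = T.outStar u q.1 := by
  induction u generalizing q with
  | nil => rfl
  | cons x u ih =>
    have : (T.restrictTo P).tr x q = (⟨T.tr x q.1, hP x q.1 q.2⟩ : {q : T.Q // P q}) :=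
      dif_pos (hP x q.1 q.2)
    change T.out x q.1 ++ (T.restrictTo P).outStar u ((T.restrictTo P).tr x q) = _
    rw [this]
    exact congrArg _ (ih _)

theorem reach_tr (T : Transducer n) (q0 : T.Q) (x : Fin n) (q : T.Q) (hq : T.reach q0 q) :
    T.reach q0 (T.tr x q) := by
  obtain ⟨w, rfl⟩ := hq
  exact ⟨w ++ [x], transStar_append _ _ _ _⟩

theorem Induces.restrictTo_reach {T : Transducer n} {q0 q : T.Q} {f : Cantor n → Cantor n}
    (hf : T.Induces q f) (hq : T.reach q0 q) :
    (T.restrictTo (T.reach q0)).Induces (⟨q, hq⟩ : {q : T.Q // T.reach q0 q}) f := by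
  intro χ m
  obtain ⟨k, hk⟩ := hf χ m
  refine ⟨k, ?_⟩
  rwa [outStar_restrictTo T _ (T.reach_tr q0)]

theorem finite_inverseState (hn : 2 ≤ n) {T : Transducer n} [Finite T.Q]
    (hT : ∀ q, T.LocalHomeo q) : {p | T.InverseState p}.Finite := by
  choose N hN using fun q => (hT q).modulus 1
  have hlen : ∀ p, T.InverseState p → p.1.length < N p.2 := by
    intro p hp
    by_contra! hle
    obtain ⟨ρ, hρ⟩ := nonempty_preimage_cone hn hp.1
    have := hp.2.2 (takeW ρ 1) fun σ hσ => by
      rw [prefixOf_iff_takeW, takeW_length, takeW_eq_takeW_iff]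
      refine hN p.2 _ _ fun i hi => ?_
      exact (hσ i (hi.trans_le hle)).symm.trans (hρ i (hi.trans_le hle))
    simp [takeW_length] at this
  have hfin : (⋃ q, {w : List (Fin n) | w.length < N q} ×ˢ {q} : Set (List (Fin n) × T.Q)).Finite :=
    Set.finite_iUnion fun q => (List.finite_length_lt _ _).prod (Set.finite_singleton q)
  refine hfin.subset fun p hp => ?_
  exact Set.mem_iUnion.2 ⟨p.2, hlen p hp, rfl⟩

/-- A state inducing the identity turns every element of `Vₙ` into a completion. -/
theorem isCompletion_of_mem_Vn (hn : 2 ≤ n) {T : Transducer n} {q : T.Q}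
    (hq : T.Induces q id) {g : Cantor n ≃ₜ Cantor n} (hg : g ∈ Vn n) : T.IsCompletion g := by
  obtain ⟨m, α, β, hα, hβ, hg⟩ := hg
  refine ⟨m, α, β, fun _ => q, fun _ => id, hα.card_mod hn, hα, fun _ => hq, ?_, ?_, hg⟩
  · refine Set.eq_univ_of_forall fun χ => ?_
    obtain ⟨i, hi, -⟩ := hβ χ
    obtain ⟨ψ, rfl⟩ := prefixOf_iff_exists.1 hi
    exact Set.mem_iUnion.2 ⟨i, ψ, ⟨ψ, rfl⟩, rfl⟩
  · intro i j hij
    rw [Set.disjoint_left]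
    rintro _ ⟨ψ, -, rfl⟩ ⟨ψ', -, he⟩
    exact hij ((hβ _).unique (prefixOf_appendInf _ _) (he ▸ prefixOf_appendInf _ _))

end Transducer

/-- Corollaries 5.6/5.7. Let `T_{q0}` be an initial invertible
transducer with inverse `S_{(ε,q0)}`.  Then `TS ∈ 𝔓ₙ`, the state `(q0, (ε,q0))` of the
product transducer `TS` induces the identity homeomorphism, and `Vₙ ≤ 𝓗(TS)`. -/
theorem Vn_le_HGroup_of_product_with_inverse
    {n : ℕ} (hn : 2 ≤ n) (T : Transducer n) [Finite T.Q] (q0 : T.Q)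
    (h : Cantor n ≃ₜ Cantor n) (hInd : T.Induces q0 ⇑h) (hAcc : T.Accessible q0) :
    Finite (T.prod (T.invAcc q0)).Q ∧
    (T.prod (T.invAcc q0)).PartiallyInvertible ∧
    (T.prod (T.invAcc q0)).Induces
      (q0, ⟨([], q0), ⟨[], rfl⟩⟩) (id : Cantor n → Cantor n) ∧
    (∀ g ∈ Vn n, (T.prod (T.invAcc q0)).IsCompletion g) ∧
    Vn n ⊆ ↑(Transducer.HGroup (T.prod (T.invAcc q0))) := by
  have hT : ∀ q, T.LocalHomeo q := Transducer.localHomeo_of_accessible hInd hAcc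
  have hreach : ∀ p, T.invT.reach ([], q0) p → T.InverseState p := by
    rintro p ⟨u, rfl⟩
    exact (Transducer.inverseState_initial hn hInd).transStar hn hT u
  have hid : (T.prod (T.invAcc q0)).Induces
      (q0, ⟨([], q0), ⟨[], rfl⟩⟩) (id : Cantor n → Cantor n) := by
    have h0 := Transducer.inverseState_initial hn hInd
    have hcomp : T.inverseMap ([], q0) h0 ∘ h = id := by
      funext χ
      apply h.injective
      have := T.inducedMap_inverseMap ([], q0) h0 (h χ)
      rwa [hInd.inducedMap_eq, appendInf_nil] at this
    rw [← hcomp]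
    exact hInd.prod ((Transducer.induces_inverseMap hn hT h0).restrictTo_reach ⟨[], rfl⟩)
  have hcompl : ∀ g ∈ Vn n, (T.prod (T.invAcc q0)).IsCompletion g := fun g hg =>
    Transducer.isCompletion_of_mem_Vn hn hid hg
  refine ⟨?_, ?_, hid, hcompl, fun g hg => Subgroup.subset_closure (hcompl g hg)⟩
  · have : Finite (T.invAcc q0).Q :=
      ((Transducer.finite_inverseState hn hT).subset hreach).to_subtype
    exact inferInstanceAs (Finite (T.Q × (T.invAcc q0).Q))
  · rintro ⟨t, p, hp⟩
    have hps := hreach p hp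
    refine ⟨_, (hT t).induces.prod
      ((Transducer.induces_inverseMap hn hT hps).restrictTo_reach hp), ?_, ?_⟩
    · refine Function.Injective.comp (fun y z hyz => ?_) (hT t).injective
      apply appendInf_injective p.1
      rw [← T.inducedMap_inverseMap p hps, ← T.inducedMap_inverseMap p hps, hyz]
    · have hrange : Set.range (T.inverseMap p hps ∘ T.inducedMap t) =
          T.inducedMap p.2 ⁻¹' (appendInf p.1 '' Set.range (T.inducedMap t)) := by
        ext ρ
        constructor
        · rintro ⟨χ, rfl⟩
          exact ⟨_, ⟨χ, rfl⟩, (T.inducedMap_inverseMap p hps _).symm⟩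
        · rintro ⟨_, ⟨χ, rfl⟩, hχ⟩
          exact ⟨χ, (hT p.2).injective ((T.inducedMap_inverseMap p hps _).trans hχ)⟩
      rw [hrange]
      exact (isClopen_appendInf_image p.1 (hT t).isClopen_range).preimage (hT p.2).continuous
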